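/- arXiv:1602.06577 — 2 statements merged into one kernel-verified Lean document; each statement's English description precedes it below -/
import Mathlib

section
/- (Variance ratio at ρ = 0.) Fix w > 0. Define A(ρ,w) = P₂₂'(ρ,w)²/P₂₂(ρ,w) + 2·P₂₃'(ρ,w)²/P₂₃(ρ,w) + P₃₃'(ρ,w)²/P₃₃(ρ,w) + P₂₂'(−ρ,w)²/P₂₂(−ρ,w) + 2·P₂₃'(−ρ,w)²/P₂₃(−ρ,w) + P₃₃'(−ρ,w)²/P₃₃(−ρ,w), where ' denotes the derivative in ρ, and define I₁(ρ) = (1/(4π²(1−ρ²)))·[ 1/(1/4 + arcsin(ρ)/(2π)) + 1/(1/4 − arcsin(ρ)/(2π)) ]. Then the ratio at ρ = 0 satisfies A(0,w)/I₁(0) = g(w)², where g(w) = (1/2)·[ (1 − exp(−w²/2))²/(Φ(w) − 1/2) + exp(−w²)/(1 − Φ(w)) ]. -/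
open MeasureTheory Real

/-- Standard bivariate normal density with correlation `ρ`. -/
noncomputable def f (ρ x y : ℝ) : ℝ :=
  (1 / (2 * Real.pi * Real.sqrt (1 - ρ ^ 2))) *
    Real.exp (-(x ^ 2 - 2 * ρ * x * y + y ^ 2) / (2 * (1 - ρ ^ 2)))

/-- Standard normal density. -/
noncomputable def stdPhi (x : ℝ) : ℝ := (1 / Real.sqrt (2 * Real.pi)) * Real.exp (-x ^ 2 / 2)

/-- Standard normal distribution function. -/
noncomputable def stdCdf (x : ℝ) : ℝ := ∫ t in Set.Iic x, stdPhi t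

noncomputable def P22 (ρ w : ℝ) : ℝ := ∫ x in (0:ℝ)..w, ∫ y in (0:ℝ)..w, f ρ x y

noncomputable def P23 (ρ w : ℝ) : ℝ := ∫ x in (0:ℝ)..w, ∫ y in Set.Ioi w, f ρ x y

noncomputable def P33 (ρ w : ℝ) : ℝ := ∫ x in Set.Ioi w, ∫ y in Set.Ioi w, f ρ x y

noncomputable def dP22 (ρ w : ℝ) : ℝ := deriv (fun r => P22 r w) ρ
noncomputable def dP23 (ρ w : ℝ) : ℝ := deriv (fun r => P23 r w) ρ
noncomputable def dP33 (ρ w : ℝ) : ℝ := deriv (fun r => P33 r w) ρ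

/-- The Fisher information summand `A(ρ,w)`. -/
noncomputable def A (ρ w : ℝ) : ℝ :=
  (dP22 ρ w) ^ 2 / P22 ρ w + 2 * (dP23 ρ w) ^ 2 / P23 ρ w + (dP33 ρ w) ^ 2 / P33 ρ w +
  (dP22 (-ρ) w) ^ 2 / P22 (-ρ) w + 2 * (dP23 (-ρ) w) ^ 2 / P23 (-ρ) w +
  (dP33 (-ρ) w) ^ 2 / P33 (-ρ) w

/-- Fisher information (per projection) of the 1-bit estimator. -/
noncomputable def I1 (ρ : ℝ) : ℝ :=
  (1 / (4 * Real.pi ^ 2 * (1 - ρ ^ 2))) *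
    (1 / (1 / 4 + Real.arcsin ρ / (2 * Real.pi)) + 1 / (1 / 4 - Real.arcsin ρ / (2 * Real.pi)))

noncomputable def g (w : ℝ) : ℝ :=
  (1 / 2) * ((1 - Real.exp (-w ^ 2 / 2)) ^ 2 / (stdCdf w - 1 / 2) +
    Real.exp (-w ^ 2) / (1 - stdCdf w))

noncomputable def Q (S T : Set ℝ) (ρ : ℝ) : ℝ := ∫ x in S, ∫ y in T, f ρ x y

lemma quad_bound (ρ x y : ℝ) (h : |ρ| < 1/2) :
    -(x ^ 2 - 2 * ρ * x * y + y ^ 2) / (2 * (1 - ρ ^ 2)) ≤ -(x^2+y^2)/4 := by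
  obtain ⟨h1, h2⟩ := abs_lt.1 h
  have hu : 0 < 2 * (1 - ρ^2) := by nlinarith
  rw [div_le_iff₀ hu]
  nlinarith [mul_nonneg (by linarith : 0 ≤ 1/2 - ρ) (sq_nonneg (x+y)),
    mul_nonneg (by linarith : 0 ≤ 1/2 + ρ) (sq_nonneg (x-y)),
    mul_nonneg (by linarith : 0 ≤ 1/2 - ρ) (sq_nonneg (x-y)),
    mul_nonneg (by linarith : 0 ≤ 1/2 + ρ) (sq_nonneg (x+y)),
    mul_nonneg (sq_nonneg ρ) (add_nonneg (sq_nonneg x) (sq_nonneg y)), sq_nonneg (x+y), sq_nonneg (x-y)]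

lemma f_nonneg (ρ x y : ℝ) : 0 ≤ f ρ x y := by unfold f; positivity

lemma f_bound (ρ x y : ℝ) (h : |ρ| < 1/2) : f ρ x y ≤ Real.exp (-(x^2+y^2)/4) := by
  unfold f
  have hs : 1/2 ≤ Real.sqrt (1 - ρ^2) := by
    apply Real.le_sqrt_of_sq_le
    obtain ⟨h1, h2⟩ := abs_lt.1 h
    nlinarith
  have hc : 1 / (2 * Real.pi * Real.sqrt (1 - ρ ^ 2)) ≤ 1 := by
    rw [div_le_one (by positivity)]
    nlinarith [Real.pi_gt_three]
  calc _ ≤ 1 * Real.exp (-(x^2+y^2)/4) := by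
        exact mul_le_mul hc (Real.exp_le_exp.2 (quad_bound ρ x y h)) (Real.exp_pos _).le zero_le_one
    _ = _ := one_mul _

noncomputable def f' (ρ x y : ℝ) : ℝ := f ρ x y *
  (ρ / (1-ρ^2) + x*y/(1-ρ^2) - (x ^ 2 - 2 * ρ * x * y + y ^ 2) * ρ / (1-ρ^2)^2)

lemma f_deriv (ρ x y : ℝ) (h : |ρ| < 1/2) : HasDerivAt (fun r => f r x y) (f' ρ x y) ρ := by
  obtain ⟨h1, h2⟩ := abs_lt.1 h
  have hu : 0 < 1 - ρ^2 := by nlinarith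
  have hs : 0 < Real.sqrt (1 - ρ^2) := Real.sqrt_pos.2 hu
  have hs2 : Real.sqrt (1 - ρ^2) ^ 2 = 1 - ρ^2 := Real.sq_sqrt hu.le
  have d0 : HasDerivAt (fun r : ℝ => 1 - r^2) (-(2*ρ)) ρ := by
    simpa using ((hasDerivAt_id ρ).pow 2).const_sub 1
  have d1 := (d0.sqrt hu.ne').const_mul (2 * Real.pi)
  have d2 := (hasDerivAt_const ρ (1:ℝ)).div d1 (by positivity)
  have dq : HasDerivAt (fun r : ℝ => -(x ^ 2 - 2 * r * x * y + y ^ 2)) (2*x*y) ρ := by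
    have e : (fun r : ℝ => -(x ^ 2 - 2 * r * x * y + y ^ 2)) =
      fun r => (2*x*y) * r + (-(x^2+y^2)) := by funext r; ring
    rw [e]
    simpa using ((hasDerivAt_id ρ).const_mul (2*x*y)).add_const (-(x^2+y^2))
  have d3 := (dq.div (d0.const_mul 2) (by positivity)).exp
  have d4 := d2.mul d3
  refine d4.congr_deriv ?_
  unfold f' f
  simp only [Pi.div_apply]
  generalize Real.exp _ = E
  generalize Real.sqrt (1-ρ^2) = s at *
  rw [← hs2]
  have := Real.pi_pos
  field_simp
  ring

lemma f'_bound (ρ x y : ℝ) (h : |ρ| < 1/2) : ‖f' ρ x y‖ ≤ 32 * Real.exp (-(x^2+y^2)/8) := by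
  have hf := f_bound ρ x y h
  have hf0 := f_nonneg ρ x y
  have hh := h
  obtain ⟨h1, h2⟩ := abs_lt.1 h
  have hu : 3/4 ≤ 1 - ρ^2 := by nlinarith
  have hxy : |x*y| ≤ (x^2+y^2)/2 := by
    rw [abs_le]; constructor <;> nlinarith [sq_nonneg (x+y), sq_nonneg (x-y)]
  have hq : |x ^ 2 - 2 * ρ * x * y + y ^ 2| ≤ 3/2*(x^2+y^2) := by
    have : |ρ * (x*y)| ≤ (1/2) * ((x^2+y^2)/2) := by
      rw [abs_mul]; gcongr
    obtain ⟨a, b⟩ := abs_le.1 this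
    rw [abs_le]; constructor <;> nlinarith [sq_nonneg x, sq_nonneg y]
  have hA : |ρ / (1-ρ^2)| ≤ 1 := by
    rw [abs_div, abs_of_pos (by linarith : 0 < 1-ρ^2), div_le_iff₀ (by linarith)]; linarith
  have hB : |x*y / (1-ρ^2)| ≤ (x^2+y^2) := by
    rw [abs_div, abs_of_pos (by linarith : 0 < 1-ρ^2), div_le_iff₀ (by linarith)]
    nlinarith [sq_nonneg x, sq_nonneg y]
  have hC : |(x ^ 2 - 2 * ρ * x * y + y ^ 2) * ρ / (1-ρ^2)^2| ≤ 2*(x^2+y^2) := by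
    have h9 : 1/2 ≤ (1-ρ^2)^2 := by nlinarith
    rw [abs_div, abs_of_pos (by positivity : 0 < (1-ρ^2)^2), div_le_iff₀ (by positivity), abs_mul]
    calc _ ≤ 3/2*(x^2+y^2) * (1/2) := by gcongr
      _ ≤ 2*(x^2+y^2) * (1/2) := by nlinarith [sq_nonneg x, sq_nonneg y]
      _ ≤ _ := by gcongr
  have hD : |ρ / (1-ρ^2) + x*y/(1-ρ^2) - (x ^ 2 - 2 * ρ * x * y + y ^ 2) * ρ / (1-ρ^2)^2|
      ≤ 4 * (1 + (x^2+y^2)) := by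
    refine (abs_sub _ _).trans ?_
    have := abs_add_le (ρ / (1-ρ^2)) (x*y/(1-ρ^2))
    nlinarith [sq_nonneg x, sq_nonneg y]
  have hE : 1 + (x^2+y^2) ≤ 8 * Real.exp ((x^2+y^2)/8) := by
    nlinarith [Real.add_one_le_exp ((x^2+y^2)/8)]
  unfold f'
  rw [Real.norm_eq_abs, abs_mul, abs_of_nonneg hf0]
  calc _ ≤ Real.exp (-(x^2+y^2)/4) * (4 * (8 * Real.exp ((x^2+y^2)/8))) := by
        gcongr
        linarith
    _ = 32 * (Real.exp (-(x^2+y^2)/4) * Real.exp ((x^2+y^2)/8)) := by ring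
    _ = _ := by rw [← Real.exp_add]; ring_nf

lemma gauss_int (S T : Set ℝ) (b : ℝ) (hb : 0 < b) :
    Integrable (fun p : ℝ × ℝ => Real.exp (-(p.1^2+p.2^2)/b))
      ((volume.restrict S).prod (volume.restrict T)) := by
  have h := integrable_exp_neg_mul_sq (b := 1/b) (by positivity)
  have := (h.restrict (s := S)).mul_prod (h.restrict (s := T))
  refine this.congr (Filter.Eventually.of_forall fun p => ?_)
  simp only
  rw [← Real.exp_add]; congr 1; ring

lemma f_meas (ρ : ℝ) : Measurable (fun p : ℝ × ℝ => f ρ p.1 p.2) := by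
  unfold f; fun_prop

lemma f'_meas (ρ : ℝ) : Measurable (fun p : ℝ × ℝ => f' ρ p.1 p.2) := by
  unfold f' f; fun_prop

lemma f_int (S T : Set ℝ) (ρ : ℝ) (h : |ρ| < 1/2) : Integrable (fun p : ℝ × ℝ => f ρ p.1 p.2)
      ((volume.restrict S).prod (volume.restrict T)) := by
  refine (gauss_int S T 4 (by norm_num)).mono' (f_meas ρ).aestronglyMeasurable
    (Filter.Eventually.of_forall fun p => ?_)
  rw [Real.norm_eq_abs, abs_of_nonneg (f_nonneg _ _ _)]
  exact f_bound _ _ _ h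

lemma Q_deriv (S T : Set ℝ) : deriv (Q S T) 0 =
    (1/(2*Real.pi)) * ((∫ x in S, x * Real.exp (-x^2/2)) * ∫ x in T, x * Real.exp (-x^2/2)) := by
  have hb : Metric.ball (0:ℝ) (1/2) ∈ nhds (0:ℝ) := Metric.ball_mem_nhds _ (by norm_num)
  have hm : ∀ r ∈ Metric.ball (0:ℝ) (1/2), |r| < 1/2 := by
    intro r hr; simpa [Real.dist_eq] using hr
  have key := (hasDerivAt_integral_of_dominated_loc_of_deriv_le
    (μ := (volume.restrict S).prod (volume.restrict T))
    (F := fun r (p : ℝ × ℝ) => f r p.1 p.2) (F' := fun r p => f' r p.1 p.2) (x₀ := 0)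
    (bound := fun p => 32 * Real.exp (-(p.1^2+p.2^2)/8)) hb
    (Filter.Eventually.of_forall fun r => (f_meas r).aestronglyMeasurable)
    (f_int S T 0 (by norm_num)) (f'_meas 0).aestronglyMeasurable
    (Filter.Eventually.of_forall fun p r hr => f'_bound r p.1 p.2 (hm r hr))
    ((gauss_int S T 8 (by norm_num)).const_mul 32)
    (Filter.Eventually.of_forall fun p r hr => f_deriv r p.1 p.2 (hm r hr))).2
  have e : Q S T =ᶠ[nhds 0] fun r => ∫ p, f r p.1 p.2 ∂((volume.restrict S).prod (volume.restrict T)) := by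
    filter_upwards [hb] with r hr
    exact (integral_prod _ (f_int S T r (hm r hr))).symm
  rw [(key.congr_of_eventuallyEq e).deriv, ← integral_prod_mul, ← integral_const_mul]
  congr 1
  funext p
  unfold f' f
  have : Real.exp (-(p.1^2+p.2^2)/2) = Real.exp (-p.1^2/2) * Real.exp (-p.2^2/2) := by
    rw [← Real.exp_add]; congr 1; ring
  simp [← neg_add_rev, add_comm, this]
  ring

lemma Q_zero (S T : Set ℝ) : Q S T 0 = (∫ x in S, stdPhi x) * ∫ x in T, stdPhi x := by
  unfold Q
  rw [← integral_mul_const]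
  congr 1
  funext x
  rw [← integral_const_mul]
  congr 1
  funext y
  unfold f stdPhi
  have hs : Real.sqrt (2*Real.pi) * Real.sqrt (2*Real.pi) = 2 * Real.pi :=
    Real.mul_self_sqrt (by positivity)
  have : Real.exp (-(x^2 - 2*0*x*y + y^2)/(2*(1-0^2))) = Real.exp (-x^2/2) * Real.exp (-y^2/2) := by
    rw [← Real.exp_add]; congr 1; ring
  rw [this]
  simp only [ne_eq, OfNat.ofNat_ne_zero, not_false_eq_true, zero_pow, sub_zero, Real.sqrt_one, mul_one]
  have h2 : 1 / (2 * Real.pi) = (1 / Real.sqrt (2*Real.pi)) * (1 / Real.sqrt (2*Real.pi)) := by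
    rw [one_div_mul_one_div, hs]
  rw [h2]
  ring

lemma prim (x : ℝ) : HasDerivAt (fun x => -Real.exp (-x^2/2)) (x * Real.exp (-x^2/2)) x := by
  have : HasDerivAt (fun x : ℝ => -x^2/2) (-x) x := by
    have := (((hasDerivAt_id x).pow 2).neg).div_const 2
    refine this.congr_deriv ?_
    simp; ring
  refine this.exp.neg.congr_deriv ?_
  ring

lemma int1 (w : ℝ) (hw : 0 < w) :
    ∫ x in Set.Ioc 0 w, x * Real.exp (-x^2/2) = 1 - Real.exp (-w^2/2) := by
  rw [← intervalIntegral.integral_of_le hw.le,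
    intervalIntegral.integral_eq_sub_of_hasDerivAt (fun x _ => prim x)
      (Continuous.intervalIntegrable (by fun_prop) _ _)]
  simp; ring

lemma int2 (w : ℝ) (hw : 0 < w) :
    ∫ x in Set.Ioi w, x * Real.exp (-x^2/2) = Real.exp (-w^2/2) := by
  have ht : Filter.Tendsto (fun x : ℝ => -Real.exp (-x^2/2)) Filter.atTop (nhds 0) := by
    rw [← neg_zero]
    refine (Real.tendsto_exp_atBot.comp ?_).neg
    have h : Filter.Tendsto (fun x : ℝ => x^2/2) Filter.atTop Filter.atTop :=
      (Filter.tendsto_pow_atTop (by norm_num)).atTop_div_const (by norm_num)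
    refine (Filter.tendsto_neg_atTop_atBot.comp h).congr fun x => ?_
    simp; ring
  have := integral_Ioi_of_hasDerivAt_of_nonneg' (a := w) (fun x _ => prim x)
    (fun x hx => mul_nonneg (hw.le.trans (le_of_lt hx)) (Real.exp_pos _).le) ht
  rw [this]; ring

lemma phi_eq : stdPhi = fun x => (1 / Real.sqrt (2 * Real.pi)) * Real.exp (-(1/2) * x ^ 2) := by
  funext x; unfold stdPhi; congr 2; ring

lemma phi_int : Integrable stdPhi := by
  rw [phi_eq]
  exact (integrable_exp_neg_mul_sq (by norm_num)).const_mul _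

lemma phi_total : ∫ x, stdPhi x = 1 := by
  rw [phi_eq, integral_const_mul, integral_gaussian]
  have : Real.pi / (1/2) = 2 * Real.pi := by ring
  rw [this, one_div, inv_mul_cancel₀ (by positivity)]

lemma phi_half : ∫ x in Set.Ioi 0, stdPhi x = 1/2 := by
  rw [phi_eq, integral_const_mul, integral_gaussian_Ioi]
  have : Real.pi / (1/2) = 2 * Real.pi := by ring
  rw [this]
  have : Real.sqrt (2 * Real.pi) ≠ 0 := by positivity
  field_simp

lemma tail (w : ℝ) : ∫ x in Set.Ioi w, stdPhi x = 1 - stdCdf w := by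
  have := intervalIntegral.integral_Iic_add_Ioi (b := w) phi_int.integrableOn phi_int.integrableOn
  rw [phi_total] at this
  unfold stdCdf; linarith

lemma mid (w : ℝ) (hw : 0 < w) : ∫ x in Set.Ioc 0 w, stdPhi x = stdCdf w - 1/2 := by
  have h := setIntegral_union (μ := volume) (f := stdPhi) (Set.Ioc_disjoint_Ioi (le_refl w) : Disjoint (Set.Ioc 0 w) _)
    measurableSet_Ioi phi_int.integrableOn phi_int.integrableOn
  rw [Set.Ioc_union_Ioi_eq_Ioi hw.le, phi_half, tail] at h
  linarith

theorem stmt16 (w : ℝ) (hw : 0 < w) : A 0 w / I1 0 = (g w) ^ 2 := by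
  have e22 : (fun r => P22 r w) = Q (Set.Ioc 0 w) (Set.Ioc 0 w) := by
    funext r; simp only [P22, Q, intervalIntegral.integral_of_le hw.le]
  have e23 : (fun r => P23 r w) = Q (Set.Ioc 0 w) (Set.Ioi w) := by
    funext r; simp only [P23, Q, intervalIntegral.integral_of_le hw.le]
  have e33 : (fun r => P33 r w) = Q (Set.Ioi w) (Set.Ioi w) := rfl
  have p22 : P22 0 w = _ := (congrFun e22 0).trans (Q_zero _ _)
  have p23 : P23 0 w = _ := (congrFun e23 0).trans (Q_zero _ _)
  have p33 : P33 0 w = _ := (congrFun e33 0).trans (Q_zero _ _)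
  have hexp : Real.exp (-w^2) = Real.exp (-w^2/2) ^ 2 := by
    rw [← Real.exp_nat_mul]; congr 1; push_cast; ring
  unfold A dP22 dP23 dP33 I1 g
  rw [neg_zero, p22, p23, p33, e22, e23, e33, Q_deriv, Q_deriv, Q_deriv, int1 w hw, int2 w hw,
    tail, mid w hw, hexp, Real.arcsin_zero]
  generalize 1 - stdCdf w = b
  generalize stdCdf w - 1/2 = a
  generalize Real.exp _ = E
  have hI : (1 / (4 * Real.pi ^ 2 * (1 - 0 ^ 2))) *
    (1 / (1 / 4 + 0 / (2 * Real.pi)) + 1 / (1 / 4 - 0 / (2 * Real.pi))) = 2 * Real.pi⁻¹ ^ 2 := by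
    norm_num; ring
  rw [hI]
  have hp : Real.pi⁻¹ ≠ 0 := inv_ne_zero Real.pi_ne_zero
  rw [div_eq_iff (by positivity)]
  ring
end

section
/- For every w > 0, the collision probability of the uniform quantization scheme, P_w(ρ) := the measure of the set {(x,y) ∈ ℝ² : ⌊x/w⌋ = ⌊y/w⌋} with respect to the measure on ℝ² with density f_ρ, is a strictly increasing function of ρ on the interval [0, 1). -/
open MeasureTheory Real

/-- The standard bivariate normal measure with correlation `ρ` on `ℝ × ℝ`. -/
noncomputable def biMeasure (ρ : ℝ) : Measure (ℝ × ℝ) :=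
  volume.withDensity (fun p => ENNReal.ofReal (f ρ p.1 p.2))

/-- Collision probability of the uniform quantization scheme. -/
noncomputable def Pw (w ρ : ℝ) : ℝ :=
  (biMeasure ρ {p : ℝ × ℝ | ⌊p.1 / w⌋ = ⌊p.2 / w⌋}).toReal


noncomputable def fx (r x y : ℝ) : ℝ := f r x y * (-(x - r * y) / (1 - r ^ 2))
noncomputable def gg (r x y : ℝ) : ℝ :=
  f r x y * (r / (1 - r ^ 2) + (x - r * y) * (y - r * x) / (1 - r ^ 2) ^ 2)

lemma f_symm (r x y : ℝ) : f r x y = f r y x := by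
  unfold f; congr 3; ring

lemma f_pos {r : ℝ} (h : 0 < 1 - r ^ 2) (x y : ℝ) : 0 < f r x y := by
  unfold f
  have := Real.sqrt_pos.2 h
  positivity

lemma f_dx {r : ℝ} (h : 0 < 1 - r ^ 2) (x y : ℝ) :
    HasDerivAt (fun x => f r x y) (fx r x y) x := by
  unfold fx f
  have h1 : HasDerivAt (fun x : ℝ => -(x ^ 2 - 2 * r * x * y + y ^ 2) / (2 * (1 - r ^ 2)))
      (-(2 * x - 2 * r * y) / (2 * (1 - r ^ 2))) x := by
    have := (((((hasDerivAt_id x).pow 2).sub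
      (((hasDerivAt_id x).const_mul (2 * r)).mul_const y)).add_const (y ^ 2)).neg).div_const
        (2 * (1 - r ^ 2))
    refine HasDerivAt.congr_deriv (this) ?_
    simp
  refine HasDerivAt.congr_deriv ((h1.exp).const_mul (1 / (2 * Real.pi * Real.sqrt (1 - r ^ 2)))) ?_
  field_simp

lemma fx_dy {r : ℝ} (h : 0 < 1 - r ^ 2) (x y : ℝ) :
    HasDerivAt (fun y => fx r x y) (gg r x y) y := by
  unfold fx gg
  have h1 : HasDerivAt (fun y => f r x y) (fx r y x) y := by
    simp_rw [f_symm r x]; exact f_dx h y x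
  have h2 : HasDerivAt (fun y : ℝ => (-(x - r * y) / (1 - r ^ 2))) (r / (1 - r ^ 2)) y := by
    have := ((((hasDerivAt_id y).const_mul r).const_sub x).neg).div_const (1 - r ^ 2)
    refine HasDerivAt.congr_deriv (this) ?_
    simp
  refine HasDerivAt.congr_deriv (h1.mul h2) ?_
  unfold fx
  rw [f_symm r y x]
  field_simp
  ring

lemma f_dr {r : ℝ} (h : 0 < 1 - r ^ 2) (x y : ℝ) :
    HasDerivAt (fun r => f r x y) (gg r x y) r := by
  unfold gg f
  have hs := Real.sqrt_pos.2 h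
  have h0 : HasDerivAt (fun r : ℝ => 1 - r ^ 2) (-(2 * r)) r := by
    refine HasDerivAt.congr_deriv (((hasDerivAt_id r).pow 2).const_sub 1) ?_
    simp
  have h1 := (h0.sqrt h.ne').const_mul (2 * Real.pi)
  have h2 := h1.inv (by positivity)
  have h3 : HasDerivAt (fun r : ℝ => -(x ^ 2 - 2 * r * x * y + y ^ 2)) (2 * x * y) r := by
    have := (((((hasDerivAt_id r).const_mul 2).mul_const x).mul_const y).const_sub
      (x ^ 2) |>.add_const (y ^ 2)).neg
    refine HasDerivAt.congr_deriv (this) ?_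
    simp
  have h4 := (h3.div (h0.const_mul 2) (by positivity)).exp
  have h5 := h2.mul h4
  simp only [one_div]
  refine HasDerivAt.congr_deriv (h5) ?_
  simp only [Pi.inv_apply]
  have e : Real.sqrt (1 - r ^ 2) ^ 2 = 1 - r ^ 2 := Real.sq_sqrt h.le
  generalize Real.sqrt (1 - r ^ 2) = s at *
  have e' : r ^ 2 = 1 - s ^ 2 := by linarith
  generalize Real.exp _ = E
  rw [← e]
  field_simp
  ring_nf
  simp only [show r ^ 3 = r * (1 - s ^ 2) by rw [← e']; ring, e']
  ring

lemma f_cont : ContinuousOn (fun p : ℝ × ℝ × ℝ => f p.1 p.2.1 p.2.2) {p | 0 < 1 - p.1 ^ 2} := by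
  unfold f
  have : ∀ p ∈ {p : ℝ × ℝ × ℝ | 0 < 1 - p.1 ^ 2}, 2 * π * √(1 - p.1 ^ 2) ≠ 0 := by
    intro p hp
    have := Real.sqrt_pos.2 hp
    positivity
  have h2 : ∀ p ∈ {p : ℝ × ℝ × ℝ | 0 < 1 - p.1 ^ 2}, 2 * (1 - p.1 ^ 2) ≠ 0 := by
    intro p hp
    have : 0 < 1 - p.1 ^ 2 := hp
    positivity
  apply ContinuousOn.mul
  · exact ContinuousOn.div (by fun_prop) (by fun_prop) this
  · exact ContinuousOn.rexp (ContinuousOn.div (by fun_prop) (by fun_prop) h2)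

lemma fx_cont : ContinuousOn (fun p : ℝ × ℝ × ℝ => fx p.1 p.2.1 p.2.2) {p | 0 < 1 - p.1 ^ 2} := by
  unfold fx
  exact f_cont.mul (ContinuousOn.div (by fun_prop) (by fun_prop) (fun p hp => ne_of_gt hp))

lemma gg_cont : ContinuousOn (fun p : ℝ × ℝ × ℝ => gg p.1 p.2.1 p.2.2) {p | 0 < 1 - p.1 ^ 2} := by
  unfold gg
  exact f_cont.mul ((ContinuousOn.div (by fun_prop) (by fun_prop) (fun p hp => ne_of_gt hp)).add
    (ContinuousOn.div (by fun_prop) (by fun_prop) (fun p hp => pow_ne_zero 2 (ne_of_gt hp))))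

lemma key {s t a b : ℝ} (hs : 0 ≤ s) (hst : s ≤ t) (ht : t < 1) :
    (∫ x in a..b, ∫ y in a..b, f t x y) - (∫ x in a..b, ∫ y in a..b, f s x y)
      = ∫ r in s..t, (f r b b - f r a b - (f r b a - f r a a)) := by
  have hpos : ∀ r ∈ Set.uIcc s t, 0 < 1 - r ^ 2 := by
    intro r hr
    rw [Set.uIcc_of_le hst] at hr
    nlinarith [hr.1, hr.2]
  have hp1 : 0 < 1 - s ^ 2 := hpos s Set.left_mem_uIcc
  have hp2 : 0 < 1 - t ^ 2 := hpos t Set.right_mem_uIcc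
  have cf : ∀ {r : ℝ}, 0 < 1 - r ^ 2 → Continuous (fun p : ℝ × ℝ => f r p.1 p.2) := by
    intro r hr
    exact f_cont.comp_continuous (f := fun p : ℝ × ℝ => (r, p.1, p.2)) (by fun_prop) (fun _ => hr)
  have cF : ∀ {r : ℝ}, 0 < 1 - r ^ 2 → Continuous (fun x => ∫ y in a..b, f r x y) := by
    intro r hr
    exact intervalIntegral.continuous_parametric_intervalIntegral_of_continuous' (cf hr) a b
  rw [← intervalIntegral.integral_sub ((cF hp2).intervalIntegrable _ _)
    ((cF hp1).intervalIntegrable _ _)]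
  have cx : ∀ {r : ℝ}, 0 < 1 - r ^ 2 → Continuous (fun p : ℝ × ℝ => fx r p.1 p.2) := by
    intro r hr
    exact fx_cont.comp_continuous (f := fun p : ℝ × ℝ => (r, p.1, p.2)) (by fun_prop) (fun _ => hr)
  have cg : ∀ {r : ℝ}, 0 < 1 - r ^ 2 → Continuous (fun p : ℝ × ℝ => gg r p.1 p.2) := by
    intro r hr
    exact gg_cont.comp_continuous (f := fun p : ℝ × ℝ => (r, p.1, p.2)) (by fun_prop) (fun _ => hr)
  have inner : ∀ x, (∫ y in a..b, f t x y) - (∫ y in a..b, f s x y)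
      = ∫ r in s..t, (fx r x b - fx r x a) := by
    intro x
    have c1 : ∀ {r : ℝ}, 0 < 1 - r ^ 2 → Continuous (fun y => f r x y) :=
      fun hr => (cf hr).comp (by fun_prop : Continuous fun y : ℝ => (x, y))
    rw [← intervalIntegral.integral_sub ((c1 hp2).intervalIntegrable _ _)
      ((c1 hp1).intervalIntegrable _ _)]
    have e1 : ∀ y, f t x y - f s x y = ∫ r in s..t, gg r x y := by
      intro y
      rw [intervalIntegral.integral_eq_sub_of_hasDerivAt (fun r hr => f_dr (hpos r hr) x y)]
      apply ContinuousOn.intervalIntegrable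
      exact gg_cont.comp (f := fun r : ℝ => (r, x, y)) (by fun_prop) (fun r hr => hpos r hr)
    simp_rw [e1]
    rw [intervalIntegral_intervalIntegral_swap]
    · apply intervalIntegral.integral_congr
      intro r hr
      apply intervalIntegral.integral_eq_sub_of_hasDerivAt (fun y _ => fx_dy (hpos r hr) x y)
      exact ((cg (hpos r hr)).comp
        (by fun_prop : Continuous fun y : ℝ => (x, y))).intervalIntegrable _ _
    · refine IntegrableOn.mono_set (ContinuousOn.integrableOn_compact
        (isCompact_uIcc.prod (isCompact_uIcc (a := s) (b := t))) ?_)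
        (Set.prod_mono Set.uIoc_subset_uIcc Set.uIoc_subset_uIcc)
      exact gg_cont.comp (f := fun p : ℝ × ℝ => (p.2, x, p.1)) (by fun_prop)
        (fun p hp => hpos p.2 hp.2)
  simp_rw [inner]
  rw [intervalIntegral_intervalIntegral_swap]
  · apply intervalIntegral.integral_congr
    intro r hr
    have e : ∀ y, ∫ x in a..b, fx r x y = f r b y - f r a y := by
      intro y
      apply intervalIntegral.integral_eq_sub_of_hasDerivAt (fun x _ => f_dx (hpos r hr) x y)
      exact ((cx (hpos r hr)).comp
        (by fun_prop : Continuous fun x : ℝ => (x, y))).intervalIntegrable _ _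
    have ii : ∀ y, IntervalIntegrable (fun x => fx r x y) volume a b := fun y =>
      ((cx (hpos r hr)).comp
        (by fun_prop : Continuous fun x : ℝ => (x, y))).intervalIntegrable _ _
    simp only
    rw [intervalIntegral.integral_sub (ii b) (ii a), e, e]
  · refine IntegrableOn.mono_set (ContinuousOn.integrableOn_compact
      (isCompact_uIcc.prod (isCompact_uIcc (a := s) (b := t))) ?_)
      (Set.prod_mono Set.uIoc_subset_uIcc Set.uIoc_subset_uIcc)
    exact (fx_cont.comp (f := fun p : ℝ × ℝ => (p.2, p.1, b)) (by fun_prop)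
        (fun p hp => hpos p.2 hp.2)).sub (fx_cont.comp (f := fun p : ℝ × ℝ => (p.2, p.1, a))
        (by fun_prop) (fun p hp => hpos p.2 hp.2))

lemma corner {r a b : ℝ} (h0 : 0 < r) (h1 : r < 1) (hab : a < b) :
    0 < f r b b - f r a b - (f r b a - f r a a) := by
  have hp : 0 < 1 - r ^ 2 := by nlinarith
  rw [f_symm r b a]
  unfold f
  have hC : 0 < 1 / (2 * Real.pi * Real.sqrt (1 - r ^ 2)) := by
    have := Real.sqrt_pos.2 hp
    positivity
  generalize 1 / (2 * Real.pi * Real.sqrt (1 - r ^ 2)) = C at hC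
  set A := -(a ^ 2 - 2 * r * a * a + a ^ 2) / (2 * (1 - r ^ 2)) with hA
  set B := -(b ^ 2 - 2 * r * b * b + b ^ 2) / (2 * (1 - r ^ 2)) with hB
  set D := -(a ^ 2 - 2 * r * a * b + b ^ 2) / (2 * (1 - r ^ 2)) with hD
  have hlt : D < A / 2 + B / 2 := by
    have : A / 2 + B / 2 - D = r * (b - a) ^ 2 / (2 * (1 - r ^ 2)) := by
      rw [hA, hB, hD]; field_simp; ring
    have h2 : 0 < r * (b - a) ^ 2 / (2 * (1 - r ^ 2)) := by
      have : 0 < b - a := by linarith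
      positivity
    linarith
  have h3 := Real.exp_lt_exp.2 hlt
  rw [Real.exp_add] at h3
  have eA : Real.exp A = Real.exp (A / 2) ^ 2 := by rw [← Real.exp_nat_mul]; congr 1; push_cast; ring
  have eB : Real.exp B = Real.exp (B / 2) ^ 2 := by rw [← Real.exp_nat_mul]; congr 1; push_cast; ring
  have h4 : 0 < Real.exp A + Real.exp B - 2 * Real.exp D := by
    rw [eA, eB]; nlinarith [sq_nonneg (Real.exp (A / 2) - Real.exp (B / 2))]
  nlinarith [mul_pos hC h4]

lemma square_lt {s t a b : ℝ} (hs : 0 ≤ s) (hst : s < t) (ht : t < 1) (hab : a < b) :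
    (∫ x in a..b, ∫ y in a..b, f s x y) < (∫ x in a..b, ∫ y in a..b, f t x y) := by
  rw [← sub_pos, key hs hst.le ht]
  apply intervalIntegral.intervalIntegral_pos_of_pos_on _ _ hst
  · apply ContinuousOn.intervalIntegrable
    have c : ∀ x y, ContinuousOn (fun r => f r x y) (Set.uIcc s t) := by
      intro x y r hr
      rw [Set.uIcc_of_le hst.le] at hr
      exact (f_dr (by nlinarith [hr.1, hr.2]) x y).continuousAt.continuousWithinAt
    exact ((c _ _).sub (c _ _)).sub ((c _ _).sub (c _ _))
  · intro r hr
    exact corner (by linarith [hr.1]) (by linarith [hr.2]) hab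

lemma f_integrable {r : ℝ} (h0 : 0 ≤ r) (h1 : r < 1) :
    Integrable (fun p : ℝ × ℝ => f r p.1 p.2) := by
  have hp : 0 < 1 - r ^ 2 := by nlinarith
  have hb : 0 < 1 / (2 * (1 + r)) := by positivity
  have hi := ((integrable_exp_neg_mul_sq hb).mul_prod (integrable_exp_neg_mul_sq hb)).const_mul
    (1 / (2 * Real.pi * Real.sqrt (1 - r ^ 2)))
  have cf : Continuous (fun p : ℝ × ℝ => f r p.1 p.2) :=
    f_cont.comp_continuous (f := fun p : ℝ × ℝ => (r, p.1, p.2)) (by fun_prop) (fun _ => hp)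
  refine Integrable.mono' hi cf.aestronglyMeasurable (Filter.Eventually.of_forall fun p => ?_)
  rw [Real.norm_of_nonneg (f_pos hp _ _).le]
  unfold f
  rw [← Real.exp_add]
  apply mul_le_mul_of_nonneg_left _ (by positivity)
  apply Real.exp_le_exp.2
  have h2 : 0 < 1 - r := by linarith
  have : -(1 / (2 * (1 + r))) * p.1 ^ 2 + -(1 / (2 * (1 + r))) * p.2 ^ 2
    - -(p.1 ^ 2 - 2 * r * p.1 * p.2 + p.2 ^ 2) / (2 * (1 - r ^ 2))
    = r * (p.1 - p.2) ^ 2 / (2 * (1 - r ^ 2)) := by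
      have e : 1 - r ^ 2 = (1 - r) * (1 + r) := by ring
      rw [e]
      field_simp
      ring
  have h3 : 0 ≤ r * (p.1 - p.2) ^ 2 / (2 * (1 - r ^ 2)) := by positivity
  linarith

lemma meas_square {r a b : ℝ} (h0 : 0 ≤ r) (h1 : r < 1) (hab : a ≤ b) :
    biMeasure r (Set.Ico a b ×ˢ Set.Ico a b)
      = ENNReal.ofReal (∫ x in a..b, ∫ y in a..b, f r x y) := by
  have hp : 0 < 1 - r ^ 2 := by nlinarith
  unfold biMeasure
  rw [withDensity_apply _ (measurableSet_Ico.prod measurableSet_Ico),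
    ← ofReal_integral_eq_lintegral_ofReal (f_integrable h0 h1).integrableOn
      (Filter.Eventually.of_forall fun p => (f_pos hp _ _).le)]
  rw [Measure.volume_eq_prod, setIntegral_prod _ (f_integrable h0 h1).integrableOn]
  simp_rw [intervalIntegral.integral_of_le hab, integral_Ico_eq_integral_Ioc]

lemma biMeasure_finite {r : ℝ} (h0 : 0 ≤ r) (h1 : r < 1) : IsFiniteMeasure (biMeasure r) :=
  isFiniteMeasure_withDensity_ofReal (f_integrable h0 h1).2

lemma set_eq {w : ℝ} (hw : 0 < w) : {p : ℝ × ℝ | ⌊p.1 / w⌋ = ⌊p.2 / w⌋}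
    = ⋃ i : ℤ, Set.Ico (i * w) ((i + 1) * w) ×ˢ Set.Ico (i * w) ((i + 1) * w) := by
  have key : ∀ (x : ℝ) (i : ℤ), x ∈ Set.Ico (i * w) ((i + 1) * w) ↔ ⌊x / w⌋ = i := by
    intro x i
    rw [Int.floor_eq_iff, le_div_iff₀ hw, div_lt_iff₀ hw, Set.mem_Ico]
  ext p
  simp only [Set.mem_iUnion, Set.mem_prod, key, Set.mem_ofPred_eq]
  constructor
  · intro h; exact ⟨_, h, rfl⟩
  · rintro ⟨i, h, h'⟩; rw [h, h']

lemma meas_eq {w : ℝ} (hw : 0 < w) {r : ℝ} (h0 : 0 ≤ r) (h1 : r < 1) :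
    biMeasure r {p : ℝ × ℝ | ⌊p.1 / w⌋ = ⌊p.2 / w⌋}
      = ∑' i : ℤ, ENNReal.ofReal (∫ x in (i * w)..((i + 1) * w),
          ∫ y in (i * w)..((i + 1) * w), f r x y) := by
  rw [set_eq hw, measure_iUnion]
  · congr 1
    ext i
    exact meas_square h0 h1 (by nlinarith)
  · intro i j hij
    rw [Function.onFun, Set.disjoint_left]
    intro p hp hq
    have key : ∀ (x : ℝ) (i : ℤ), x ∈ Set.Ico (i * w) ((i + 1) * w) → ⌊x / w⌋ = i := by
      intro x i
      rw [Int.floor_eq_iff, le_div_iff₀ hw, div_lt_iff₀ hw, Set.mem_Ico]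
      exact id
    exact hij ((key _ _ hp.1).symm.trans (key _ _ hq.1))
  · intro i
    exact measurableSet_Ico.prod measurableSet_Ico

theorem stmt18 (w : ℝ) (hw : 0 < w) : StrictMonoOn (fun ρ => Pw w ρ) (Set.Ico (0:ℝ) 1) := by
  intro s hs t ht hst
  have := biMeasure_finite hs.1 hs.2
  have := biMeasure_finite ht.1 ht.2
  have fs := measure_ne_top (biMeasure s) {p : ℝ × ℝ | ⌊p.1 / w⌋ = ⌊p.2 / w⌋}
  have ft := measure_ne_top (biMeasure t) {p : ℝ × ℝ | ⌊p.1 / w⌋ = ⌊p.2 / w⌋}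
  unfold Pw
  apply (ENNReal.toReal_lt_toReal fs ft).2
  rw [meas_eq hw hs.1 hs.2] at fs ⊢
  rw [meas_eq hw ht.1 ht.2]
  have hlt : ∀ i : ℤ, (∫ x in (i * w)..((i + 1) * w), ∫ y in (i * w)..((i + 1) * w), f s x y)
      < (∫ x in (i * w)..((i + 1) * w), ∫ y in (i * w)..((i + 1) * w), f t x y) :=
    fun i => square_lt hs.1 hst ht.2 (by nlinarith)
  refine ENNReal.tsum_lt_tsum (i := 0) fs (fun i => ENNReal.ofReal_le_ofReal (hlt i).le) ?_
  refine (ENNReal.ofReal_lt_ofReal_iff_of_nonneg ?_).2 (hlt 0)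
  have hp : 0 < 1 - s ^ 2 := by nlinarith [hs.1, hs.2]
  have hl : ((0 : ℤ) : ℝ) * w ≤ (((0 : ℤ) : ℝ) + 1) * w := by nlinarith
  exact intervalIntegral.integral_nonneg hl fun x _ =>
    intervalIntegral.integral_nonneg hl fun y _ => (f_pos hp x y).le
end
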